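/- Let f ∈ L_p(𝕋ⁿ) with mean zero, p ≥ 2, and for S ⊆ [n] let f_S = ∑_{g ∈ ℤ^S} f̂(g) e^{2πi⟨·,g⟩}, the Fourier truncation of f to frequencies supported in coordinates S. Then combining the Poincaré inequality on 𝕋ⁿ with the scalar Rosenthal inequality for the variables σ_j yields: (1/C(n,k)) ∑_{|S|=k} ‖f_S‖_p^p ≲_p (k/n) ∑_{j=1}^n ‖∂_{e_j} f‖_p^p + (k/n)^{p/2} ‖∇f‖_p^p, where ∂_{e_j} is the j-th partial derivative and ‖∇f‖_p^p = E_ε ‖∑_j ε_j ∂_{e_j} f‖_p^p. -/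

import Mathlib

open MeasureTheory
open scoped ENNReal

/-- The character x ↦ e^{2πi⟨x,g⟩} on the n-torus. -/
noncomputable def torusChar (n : ℕ) (g : Fin n → ℤ) (x : Fin n → AddCircle (1 : ℝ)) : ℂ :=
  ∏ j, (AddCircle.toCircle (g j • x j) : ℂ)

/-- The trigonometric polynomial f = ∑_g c_g e^{2πi⟨·,g⟩}. -/
noncomputable def trigPoly (n : ℕ) (c : (Fin n → ℤ) →₀ ℂ) :
    (Fin n → AddCircle (1 : ℝ)) → ℂ :=
  fun x => ∑ g ∈ c.support, c g * torusChar n g x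

open Classical in
/-- The Fourier truncation f_S = ∑_{g ∈ ℤ^S} c_g e^{2πi⟨·,g⟩}. -/
noncomputable def truncF (n : ℕ) (c : (Fin n → ℤ) →₀ ℂ) (S : Finset (Fin n)) :
    (Fin n → AddCircle (1 : ℝ)) → ℂ :=
  fun x => ∑ g ∈ c.support.filter (fun g => ∀ j ∉ S, g j = 0), c g * torusChar n g x

/-- The partial derivative ∂_{e_j} f = ∑_g 2πi g_j c_g e^{2πi⟨·,g⟩}. -/
noncomputable def derivF (n : ℕ) (c : (Fin n → ℤ) →₀ ℂ) (j : Fin n) :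
    (Fin n → AddCircle (1 : ℝ)) → ℂ :=
  fun x => ∑ g ∈ c.support, (2 * Real.pi * Complex.I * g j) * c g * torusChar n g x

/-- The ε-signed gradient ∑_j ε_j ∂_{e_j} f. -/
noncomputable def gradSignF (n : ℕ) (c : (Fin n → ℤ) →₀ ℂ) (ε : Fin n → Bool) :
    (Fin n → AddCircle (1 : ℝ)) → ℂ :=
  fun x => ∑ g ∈ c.support,
    (∑ j, (if ε j then (1 : ℂ) else -1) * (2 * Real.pi * Complex.I * g j))
      * c g * torusChar n g x


lemma samp1 {ι : Type*} [Fintype ι] [DecidableEq ι] (k : ℕ) (b : ι → ℝ) (hb : ∀ i, 0 ≤ b i)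
    (r : ℝ) (hr : 0 ≤ r) (j : ι) :
    (Fintype.card ι : ℝ) * ∑ S ∈ Finset.univ.powersetCard k,
        (if j ∈ S then (∑ i ∈ S.erase j, b i) ^ r else 0)
      ≤ k * ∑ S ∈ (Finset.univ : Finset ι).powersetCard k, (∑ i ∈ S, b i) ^ r := by
  have h1 : ∀ i : ι, ∑ S ∈ (Finset.univ : Finset ι).powersetCard k,
        (if j ∈ S then (∑ i ∈ S.erase j, b i) ^ r else 0) ≤
      ∑ S ∈ (Finset.univ : Finset ι).powersetCard k, (if i ∈ S then (∑ i ∈ S, b i) ^ r else 0) := by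
    intro i
    have h2 : ∑ S ∈ (Finset.univ : Finset ι).powersetCard k,
        (if i ∈ S then (∑ i ∈ S, b i) ^ r else 0) =
        ∑ S ∈ (Finset.univ : Finset ι).powersetCard k,
        (if j ∈ S then (∑ l ∈ S.map (Equiv.swap i j).toEmbedding, b l) ^ r else 0) := by
      symm
      refine Finset.sum_bij' (fun S _ => S.map (Equiv.swap i j).toEmbedding)
        (fun S _ => S.map (Equiv.swap i j).toEmbedding) ?_ ?_ ?_ ?_ ?_
      · intro S hS
        simpa [Finset.mem_powersetCard] using hS
      · intro S hS
        simpa [Finset.mem_powersetCard] using hS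
      · intro S hS
        ext x
        simp [Finset.mem_map_equiv]
      · intro S hS
        ext x
        simp [Finset.mem_map_equiv]
      · intro S hS
        simp [Finset.mem_map_equiv]
    rw [h2]
    refine Finset.sum_le_sum fun S _ => ?_
    split_ifs with hj
    · refine Real.rpow_le_rpow (Finset.sum_nonneg fun _ _ => hb _) ?_ hr
      refine Finset.sum_le_sum_of_subset_of_nonneg ?_ (fun _ _ _ => hb _)
      intro x hx
      rw [Finset.mem_erase] at hx
      rw [Finset.mem_map_equiv, Equiv.symm_swap]
      by_cases hxi : x = i
      · subst hxi
        simpa using hj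
      · rw [Equiv.swap_apply_of_ne_of_ne hxi hx.1]
        exact hx.2
    · exact le_rfl
  calc (Fintype.card ι : ℝ) * ∑ S ∈ Finset.univ.powersetCard k,
        (if j ∈ S then (∑ i ∈ S.erase j, b i) ^ r else 0)
      = ∑ _i : ι, ∑ S ∈ (Finset.univ : Finset ι).powersetCard k,
        (if j ∈ S then (∑ i ∈ S.erase j, b i) ^ r else 0) := by
        simp [Finset.sum_const]
    _ ≤ ∑ i : ι, ∑ S ∈ (Finset.univ : Finset ι).powersetCard k,
          (if i ∈ S then (∑ i ∈ S, b i) ^ r else 0) := Finset.sum_le_sum fun i _ => h1 i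
    _ = _ := by
        rw [Finset.sum_comm, Finset.mul_sum]
        refine Finset.sum_congr rfl fun S hS => ?_
        rw [Finset.mem_powersetCard] at hS
        rw [← Finset.sum_filter]
        simp [hS.2]

lemma add_rpow_le_two {x y r : ℝ} (hx : 0 ≤ x) (hy : 0 ≤ y) (hr : 0 ≤ r) :
    (x + y) ^ r ≤ 2 ^ r * (x ^ r + y ^ r) := by
  have h1 : (x + y) ^ r ≤ (2 * max x y) ^ r := by
    refine Real.rpow_le_rpow (by positivity) ?_ hr
    have := le_max_left x y
    have := le_max_right x y
    linarith
  rw [Real.mul_rpow (by norm_num) (le_max_of_le_left hx)] at h1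
  refine h1.trans ?_
  gcongr
  have hx' : 0 ≤ x ^ r := by positivity
  have hy' : 0 ≤ y ^ r := by positivity
  rcases max_choice x y with h | h <;> rw [h] <;> linarith

lemma young_aux {x m q : ℝ} (hx : 0 ≤ x) (hm : 0 ≤ m) (hq : 1 ≤ q) :
    m * x ^ (q - 1) ≤ x ^ q / 2 + (2 * m) ^ q := by
  have key : ∀ y : ℝ, 0 ≤ y → y * y ^ (q - 1) = y ^ q := by
    intro y hy
    rcases hy.eq_or_lt with rfl | hy
    · rw [zero_mul, Real.zero_rpow (by linarith)]
    · rw [Real.rpow_sub_one hy.ne']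
      field_simp
  have h1 : 0 ≤ x ^ q := by positivity
  have h2 : 0 ≤ (2 * m) ^ q := by positivity
  rcases le_total (2 * m) x with h | h
  · have : (2 * m) * x ^ (q - 1) ≤ x * x ^ (q - 1) := by gcongr
    rw [key x hx] at this
    linarith
  · have : (2 * m) * x ^ (q - 1) ≤ (2 * m) * (2 * m) ^ (q - 1) := by
      gcongr
    rw [key _ (by positivity)] at this
    linarith

lemma samp2 {ι : Type*} [Fintype ι] [DecidableEq ι] [Nonempty ι] (k : ℕ)
    (b : ι → ℝ) (hb : ∀ i, 0 ≤ b i) (q : ℝ) (hq : 1 ≤ q) :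
    ∑ S ∈ (Finset.univ : Finset ι).powersetCard k, (∑ i ∈ S, b i) ^ q
      ≤ ((Fintype.card ι).choose k : ℝ) *
       ((2 * 2 ^ (q - 1)) * ((k / (Fintype.card ι : ℝ)) * ∑ i, b i ^ q)
        + (2 * (2 * 2 ^ (q - 1)) ^ q) * ((k / (Fintype.card ι : ℝ)) * ∑ i, b i) ^ q) := by
  set P := (Finset.univ : Finset ι).powersetCard k with hP
  set N : ℝ := ((Fintype.card ι).choose k : ℝ) with hN
  set d : ℝ := (Fintype.card ι : ℝ) with hd
  have hd0 : 0 < d := by rw [hd]; exact_mod_cast Fintype.card_pos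
  have hPN : (P.card : ℝ) = N := by rw [hP, Finset.card_powersetCard, hN, Finset.card_univ]
  set K : ℝ := 2 ^ (q - 1) with hK
  have hK0 : 0 < K := by positivity
  have hX : ∀ S : Finset ι, 0 ≤ ∑ i ∈ S, b i := fun S => Finset.sum_nonneg fun _ _ => hb _
  have key : ∀ y : ℝ, 0 ≤ y → y * y ^ (q - 1) = y ^ q := by
    intro y hy
    rcases hy.eq_or_lt with rfl | hy
    · rw [zero_mul, Real.zero_rpow (by linarith)]
    · rw [Real.rpow_sub_one hy.ne']
      field_simp
  have h1 : ∀ S ∈ P, (∑ i ∈ S, b i) ^ q ≤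
      ∑ j, (K * b j ^ q * (if j ∈ S then (∑ i ∈ S.erase j, b i) ^ (0:ℝ) else 0)
        + K * b j * (if j ∈ S then (∑ i ∈ S.erase j, b i) ^ (q - 1) else 0)) := by
    intro S _
    rw [← key _ (hX S), Finset.sum_mul]
    rw [← Finset.sum_subset (Finset.subset_univ S)]
    · refine Finset.sum_le_sum fun j hj => ?_
      rw [if_pos hj, if_pos hj, Real.rpow_zero, ← Finset.add_sum_erase S b hj]
      have := mul_le_mul_of_nonneg_left (add_rpow_le_two (hb j) (hX (S.erase j))
        (by linarith : 0 ≤ q - 1)) (hb j)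
      rw [← key _ (hb j)]
      linarith
    · intro j _ hj
      simp [hj]
  have h2 := Finset.sum_le_sum h1
  rw [Finset.sum_comm] at h2
  have h3 : ∀ j, ∑ S ∈ P, (K * b j ^ q * (if j ∈ S then (∑ i ∈ S.erase j, b i) ^ (0:ℝ) else 0)
        + K * b j * (if j ∈ S then (∑ i ∈ S.erase j, b i) ^ (q - 1) else 0)) ≤
        K * b j ^ q * (k / d * N) + K * b j * (k / d * ∑ S ∈ P, (∑ i ∈ S, b i) ^ (q - 1)) := by
    intro j
    rw [Finset.sum_add_distrib, ← Finset.mul_sum, ← Finset.mul_sum]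
    have hbj := hb j
    gcongr
    · have := samp1 k b hb 0 le_rfl j
      simp only [Real.rpow_zero, Finset.sum_const, nsmul_eq_mul, mul_one] at this ⊢
      rw [← hP, hPN] at this
      rw [div_mul_eq_mul_div, le_div_iff₀ hd0]
      linarith
    · have := samp1 k b hb (q - 1) (by linarith) j
      rw [div_mul_eq_mul_div, le_div_iff₀ hd0]
      linarith
  have h4 := h2.trans (Finset.sum_le_sum fun j _ => h3 j)
  rw [Finset.sum_add_distrib] at h4
  set M := k / d * ∑ i, b i with hM
  have hM0 : 0 ≤ M := by
    have := hX Finset.univ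
    positivity
  have h5 : ∑ j, K * b j * (k / d * ∑ S ∈ P, (∑ i ∈ S, b i) ^ (q - 1)) =
      ∑ S ∈ P, (K * M) * (∑ i ∈ S, b i) ^ (q - 1) := by
    rw [← Finset.mul_sum, ← Finset.sum_mul, ← Finset.mul_sum, hM]
    ring
  have h6 : ∑ S ∈ P, (K * M) * (∑ i ∈ S, b i) ^ (q - 1) ≤
      ∑ S ∈ P, ((∑ i ∈ S, b i) ^ q / 2 + (2 * (K * M)) ^ q) :=
    Finset.sum_le_sum fun S _ => young_aux (hX S) (by positivity) hq
  rw [Finset.sum_add_distrib, ← Finset.sum_div, Finset.sum_const, nsmul_eq_mul, hPN] at h6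
  have h7 : (2 * (K * M)) ^ q = (2 * K) ^ q * M ^ q := by
    rw [← Real.mul_rpow (by positivity) hM0]; ring_nf
  have h8 : ∑ j, K * b j ^ q * (k / d * N) = N * (K * (k / d * ∑ j, b j ^ q)) := by
    rw [← Finset.sum_mul, ← Finset.mul_sum]; ring
  rw [h7] at h6
  rw [h5, h8] at h4
  nlinarith

lemma sign_sq (n : ℕ) (x : Fin n → ℝ) :
    ∑ ε : Fin n → Bool, (∑ j, (if ε j then (1:ℝ) else -1) * x j) ^ 2 = 2 ^ n * ∑ j, x j ^ 2 := by
  have h1 : ∀ i j : Fin n, ∑ ε : Fin n → Bool,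
      ((if ε i then (1:ℝ) else -1) * (if ε j then (1:ℝ) else -1)) =
      if i = j then 2 ^ n else 0 := by
    intro i j
    split_ifs with h
    · subst h
      have : ∀ ε : Fin n → Bool,
        ((if ε i then (1:ℝ) else -1) * (if ε i then (1:ℝ) else -1)) = 1 := by
        intro ε; split_ifs <;> norm_num
      simp [this]
    · have h2 : ∑ ε : Fin n → Bool,
          ((if ε i then (1:ℝ) else -1) * (if ε j then (1:ℝ) else -1)) =
          ∑ ε : Fin n → Bool,
          -((if ε i then (1:ℝ) else -1) * (if ε j then (1:ℝ) else -1)) := by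
        refine Finset.sum_bij' (fun ε _ => Function.update ε i (!(ε i)))
          (fun ε _ => Function.update ε i (!(ε i))) (by simp) (by simp) (by simp) (by simp) ?_
        intro ε _
        have hji : j ≠ i := fun h' => h h'.symm
        simp only [Function.update_self, Function.update_of_ne hji]
        cases ε i <;> cases ε j <;> simp
      rw [Finset.sum_neg_distrib] at h2
      linarith
  have h2 : ∀ ε : Fin n → Bool, (∑ j, (if ε j then (1:ℝ) else -1) * x j) ^ 2 =
      ∑ i, ∑ j, ((if ε i then (1:ℝ) else -1) * (if ε j then (1:ℝ) else -1)) * (x i * x j) := by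
    intro ε
    rw [sq, Finset.sum_mul_sum]
    refine Finset.sum_congr rfl fun i _ => Finset.sum_congr rfl fun j _ => by ring
  simp_rw [h2]
  rw [Finset.sum_comm]
  rw [Finset.mul_sum]
  refine Finset.sum_congr rfl fun i _ => ?_
  rw [Finset.sum_comm]
  simp_rw [← Finset.sum_mul, h1]
  simp
  ring

lemma sign_lower (n : ℕ) (a : Fin n → ℂ) (q : ℝ) (hq : 1 ≤ q) :
    (∑ j, ‖a j‖ ^ 2) ^ q ≤ (1 / 2 ^ n) * ∑ ε : Fin n → Bool,
      ‖∑ j, (if ε j then (1:ℂ) else -1) * a j‖ ^ (2 * q) := by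
  have h1 : ∑ ε : Fin n → Bool, ‖∑ j, (if ε j then (1:ℂ) else -1) * a j‖ ^ 2 =
      2 ^ n * ∑ j, ‖a j‖ ^ 2 := by
    have h2 : ∀ z : ℂ, ‖z‖ ^ 2 = z.re ^ 2 + z.im ^ 2 := by
      intro z; rw [Complex.sq_norm, Complex.normSq_apply]; ring
    simp_rw [h2, Finset.sum_add_distrib, mul_add, ← sign_sq]
    have h3 : ∀ (P : Prop) [Decidable P], (if P then (1:ℂ) else -1) =
        ((if P then (1:ℝ) else -1 : ℝ) : ℂ) := by
      intro P _; split_ifs <;> simp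
    simp_rw [h3, Complex.re_sum, Complex.im_sum, Complex.re_ofReal_mul, Complex.im_ofReal_mul]
  have h4 := Real.rpow_arith_mean_le_arith_mean_rpow (Finset.univ : Finset (Fin n → Bool))
    (fun _ => 1 / 2 ^ n) (fun ε => ‖∑ j, (if ε j then (1:ℂ) else -1) * a j‖ ^ 2)
    (fun _ _ => by positivity) (by simp) (fun _ _ => by positivity) hq
  rw [← Finset.mul_sum, h1, ← Finset.mul_sum] at h4
  have h5 : (1 / 2 ^ n : ℝ) * (2 ^ n * ∑ j, ‖a j‖ ^ 2) = ∑ j, ‖a j‖ ^ 2 := by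
    field_simp
  rw [h5] at h4
  refine h4.trans (le_of_eq ?_)
  congr 1
  refine Finset.sum_congr rfl fun ε _ => ?_
  rw [Real.rpow_mul (norm_nonneg _), Real.rpow_two]

/-- Lebesgue measure on the fundamental interval. -/
noncomputable def boxM : Measure ℝ := volume.restrict (Set.Ioc (-1 / 2) (1 / 2))

instance boxM_prob : IsProbabilityMeasure boxM := by
  constructor
  rw [boxM, Measure.restrict_apply_univ, Real.volume_Ioc]
  norm_num

lemma lintegral_rpow_jensen {α : Type*} [MeasurableSpace α] (μ : Measure α)
    [IsProbabilityMeasure μ] (f : α → ℝ≥0∞) (hf : AEMeasurable f μ) (p : ℝ) (hp : 1 < p) :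
    (∫⁻ a, f a ∂μ) ^ p ≤ ∫⁻ a, f a ^ p ∂μ := by
  have h := ENNReal.lintegral_mul_le_Lp_mul_Lq μ (Real.HolderConjugate.conjExponent hp) hf
    (aemeasurable_const (b := (1 : ℝ≥0∞)))
  simp only [Pi.mul_apply, mul_one, ENNReal.one_rpow, lintegral_one, measure_univ] at h
  have h2 := ENNReal.rpow_le_rpow h (by linarith : 0 ≤ p)
  rwa [← ENNReal.rpow_mul, one_div_mul_cancel (by linarith), ENNReal.rpow_one] at h2

lemma box_mgf (b : ℝ) : Integrable (fun u => Real.exp (b * u)) boxM ∧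
    ∫ u, Real.exp (b * u) ∂boxM ≤ Real.exp (b ^ 2 / 2) := by
  have h := ProbabilityTheory.hasSubgaussianMGF_of_mem_Icc_of_integral_eq_zero
    (μ := boxM) (X := fun u => u) (a := -1/2) (b := 1/2) aemeasurable_id' ?_ ?_
  · refine ⟨h.integrable_exp_mul b, (h.mgf_le b).trans ?_⟩
    apply Real.exp_le_exp.mpr
    have : ((‖(1/2 - (-1/2) : ℝ)‖₊ / 2) ^ 2 : NNReal) = (1/4 : NNReal) := by
      have : ‖(1/2 - (-1/2) : ℝ)‖₊ = 1 := by
        ext; norm_num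
      rw [this]
      ext; norm_num
    rw [this]
    push_cast
    nlinarith [sq_nonneg b]
  · rw [boxM]
    filter_upwards [ae_restrict_mem measurableSet_Ioc] with x hx
    exact ⟨hx.1.le, hx.2⟩
  · rw [boxM, ← intervalIntegral.integral_of_le (by norm_num), integral_id]
    norm_num

lemma pi_mgf (n : ℕ) (b : Fin n → ℝ) :
    Integrable (fun u : Fin n → ℝ => Real.exp (∑ j, u j * b j)) (Measure.pi fun _ => boxM) ∧
    ∫ u : Fin n → ℝ, Real.exp (∑ j, u j * b j) ∂(Measure.pi fun _ => boxM)
      ≤ Real.exp ((∑ j, b j ^ 2) / 2) := by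
  have h : (fun u : Fin n → ℝ => Real.exp (∑ j, u j * b j)) =
      fun u => ∏ j, (fun x => Real.exp (b j * x)) (u j) := by
    funext u
    rw [Real.exp_sum]
    simp [mul_comm]
  rw [h]
  refine ⟨Integrable.fintype_prod (fun i => (box_mgf (b i)).1), ?_⟩
  rw [integral_fintype_prod_eq_prod (𝕜 := ℝ) (fun j x => Real.exp (b j * x)),
    Finset.sum_div, Real.exp_sum]
  exact Finset.prod_le_prod (fun i _ => integral_nonneg fun _ => (Real.exp_pos _).le)
    fun i _ => (box_mgf (b i)).2

lemma rpow_le_exp_abs (p : ℝ) (hp : 0 ≤ p) (x : ℝ) :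
    |x| ^ p ≤ (1 + (⌈p⌉₊.factorial : ℝ)) * (Real.exp x + Real.exp (-x)) := by
  have h0 : Real.exp |x| ≤ Real.exp x + Real.exp (-x) := by
    rcases abs_choice x with h | h <;> rw [h] <;> linarith [Real.exp_pos x, Real.exp_pos (-x)]
  have h1 : |x| ^ p ≤ 1 + |x| ^ ⌈p⌉₊ := by
    rcases le_total |x| 1 with h | h
    · have := Real.rpow_le_one (abs_nonneg x) h hp
      have : 0 ≤ |x| ^ ⌈p⌉₊ := by positivity
      linarith
    · have := Real.rpow_le_rpow_of_exponent_le h (Nat.le_ceil p)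
      rw [Real.rpow_natCast] at this
      linarith
  have h2 := Real.pow_div_factorial_le_exp |x| (abs_nonneg x) ⌈p⌉₊
  have hf : (0:ℝ) < (⌈p⌉₊.factorial : ℝ) := by exact_mod_cast Nat.factorial_pos _
  rw [div_le_iff₀ hf] at h2
  have h3 : 1 ≤ Real.exp |x| := Real.one_le_exp (abs_nonneg x)
  nlinarith

lemma khin (p : ℝ) (hp : 2 ≤ p) : ∃ K : ℝ, 0 ≤ K ∧ ∀ (n : ℕ) (a : Fin n → ℂ),
    ∫⁻ u : Fin n → ℝ, ‖∑ j, (u j : ℂ) * a j‖ₑ ^ p ∂(Measure.pi fun _ => boxM)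
      ≤ ENNReal.ofReal (K * (∑ j, ‖a j‖ ^ 2) ^ (p / 2)) := by
  set B : ℝ := 2 ^ p * (1 + (⌈p⌉₊.factorial : ℝ)) with hB
  have hB0 : 0 ≤ B := by positivity
  refine ⟨B * (4 * Real.exp (1 / 2)), by positivity, fun n a => ?_⟩
  have hs0 : 0 ≤ ∑ j, ‖a j‖ ^ 2 := Finset.sum_nonneg fun _ _ => by positivity
  rcases hs0.eq_or_lt with h0 | hpos
  · have ha : ∀ j, a j = 0 := by
      intro j
      have := (Finset.sum_eq_zero_iff_of_nonneg (fun i _ => by positivity)).1 h0.symm j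
        (Finset.mem_univ j)
      simpa using this
    have hp0 : 0 < p := by linarith
    simp [ha, hp0]
  set s : ℝ := Real.sqrt (∑ j, ‖a j‖ ^ 2) with hs
  have hs1 : 0 < s := Real.sqrt_pos.2 hpos
  have hss : s ^ 2 = ∑ j, ‖a j‖ ^ 2 := Real.sq_sqrt hs0
  have hsp : (∑ j, ‖a j‖ ^ 2) ^ (p / 2) = s ^ p := by
    rw [← hss, ← Real.rpow_two, ← Real.rpow_mul hs1.le]
    congr 1
    ring
  have hre : ∑ j, ((a j).re / s) ^ 2 ≤ 1 := by
    simp_rw [div_pow]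
    rw [← Finset.sum_div, div_le_one (by positivity), hss]
    refine Finset.sum_le_sum fun j _ => ?_
    rw [Complex.sq_norm, Complex.normSq_apply]
    nlinarith [mul_self_nonneg (a j).im]
  have him : ∑ j, ((a j).im / s) ^ 2 ≤ 1 := by
    simp_rw [div_pow]
    rw [← Finset.sum_div, div_le_one (by positivity), hss]
    refine Finset.sum_le_sum fun j _ => ?_
    rw [Complex.sq_norm, Complex.normSq_apply]
    nlinarith [mul_self_nonneg (a j).re]
  -- the four exponential functions
  set E : (Fin n → ℝ) → (Fin n → ℝ) → ℝ := fun b u => Real.exp (∑ j, u j * b j) with hE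
  set r : Fin n → ℝ := fun j => (a j).re / s with hr
  set m : Fin n → ℝ := fun j => (a j).im / s with hm
  have hpt : ∀ u : Fin n → ℝ, ‖∑ j, (u j : ℂ) * a j‖ ^ p ≤
      B * s ^ p * (E r u + E (-r) u + (E m u + E (-m) u)) := by
    intro u
    set z := ∑ j, (u j : ℂ) * a j with hz
    have hzr : z.re = s * ∑ j, u j * r j := by
      rw [hz, Complex.re_sum, Finset.mul_sum]
      refine Finset.sum_congr rfl fun j _ => ?_
      rw [Complex.re_ofReal_mul, hr]
      field_simp
    have hzi : z.im = s * ∑ j, u j * m j := by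
      rw [hz, Complex.im_sum, Finset.mul_sum]
      refine Finset.sum_congr rfl fun j _ => ?_
      rw [Complex.im_ofReal_mul, hm]
      field_simp
    have h1 : ‖z‖ ^ p ≤ (|z.re| + |z.im|) ^ p :=
      Real.rpow_le_rpow (norm_nonneg _) (Complex.norm_le_abs_re_add_abs_im z) (by linarith)
    have h2 := add_rpow_le_two (abs_nonneg z.re) (abs_nonneg z.im) (by linarith : 0 ≤ p)
    have h3 := rpow_le_exp_abs p (by linarith) (∑ j, u j * r j)
    have h4 := rpow_le_exp_abs p (by linarith) (∑ j, u j * m j)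
    rw [hzr, hzi, abs_mul, abs_mul, abs_of_pos hs1, Real.mul_rpow hs1.le (abs_nonneg _),
      Real.mul_rpow hs1.le (abs_nonneg _)] at h2
    rw [hzr, hzi, abs_mul, abs_mul, abs_of_pos hs1] at h1
    have hneg : ∀ b : Fin n → ℝ, ∑ j, u j * (-b) j = - ∑ j, u j * b j := by
      intro b; simp
    simp only [hE, hneg]
    refine (h1.trans h2).trans ?_
    have hspos : 0 ≤ s ^ p := by positivity
    have h2p : (0:ℝ) ≤ 2 ^ p := by positivity
    calc 2 ^ p * (s ^ p * |∑ j, u j * r j| ^ p + s ^ p * |∑ j, u j * m j| ^ p)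
        = 2 ^ p * s ^ p * (|∑ j, u j * r j| ^ p + |∑ j, u j * m j| ^ p) := by ring
      _ ≤ 2 ^ p * s ^ p * ((1 + (⌈p⌉₊.factorial : ℝ)) *
            (Real.exp (∑ j, u j * r j) + Real.exp (-∑ j, u j * r j)) +
            (1 + (⌈p⌉₊.factorial : ℝ)) *
            (Real.exp (∑ j, u j * m j) + Real.exp (-∑ j, u j * m j))) := by gcongr
      _ = _ := by rw [hB]; ring
  have hExpInt : ∀ b, Integrable (E b) (Measure.pi fun _ => boxM) := fun b => (pi_mgf n b).1
  have hle : ∀ b : Fin n → ℝ, ∑ j, b j ^ 2 ≤ 1 →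
      ∫ u, E b u ∂(Measure.pi fun _ => boxM) ≤ Real.exp (1/2) := fun b hb =>
    (pi_mgf n b).2.trans (Real.exp_le_exp.2 (by linarith))
  have hEI : Integrable (fun u => B * s ^ p * (E r u + E (-r) u + (E m u + E (-m) u)))
      (Measure.pi fun _ => boxM) :=
    ((((hExpInt r).add (hExpInt (-r))).add ((hExpInt m).add (hExpInt (-m)))).const_mul _)
  calc ∫⁻ u : Fin n → ℝ, ‖∑ j, (u j : ℂ) * a j‖ₑ ^ p ∂(Measure.pi fun _ => boxM)
      ≤ ∫⁻ u : Fin n → ℝ, ENNReal.ofReal (B * s ^ p * (E r u + E (-r) u + (E m u + E (-m) u)))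
          ∂(Measure.pi fun _ => boxM) := by
        refine lintegral_mono fun u => ?_
        rw [← ofReal_norm, ENNReal.ofReal_rpow_of_nonneg (norm_nonneg _) (by linarith)]
        exact ENNReal.ofReal_le_ofReal (hpt u)
    _ = ENNReal.ofReal (∫ u : Fin n → ℝ, (B * s ^ p * (E r u + E (-r) u + (E m u + E (-m) u)))
          ∂(Measure.pi fun _ => boxM)) := by
        rw [ofReal_integral_eq_lintegral_ofReal hEI]
        refine Filter.Eventually.of_forall fun u => ?_
        have : ∀ b, 0 ≤ E b u := fun b => (Real.exp_pos _).le
        have h1 := this r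
        have h2 := this (-r)
        have h3 := this m
        have h4 := this (-m)
        simp only [Pi.zero_apply]
        positivity
    _ ≤ _ := by
        refine ENNReal.ofReal_le_ofReal ?_
        have e1 : ∫ u, (E r u + E (-r) u + (E m u + E (-m) u)) ∂(Measure.pi fun _ => boxM) =
            (∫ u, E r u ∂(Measure.pi fun _ => boxM) + ∫ u, E (-r) u ∂(Measure.pi fun _ => boxM)) +
            (∫ u, E m u ∂(Measure.pi fun _ => boxM) + ∫ u, E (-m) u ∂(Measure.pi fun _ => boxM)) := by
          rw [← integral_add (hExpInt r) (hExpInt (-r)), ← integral_add (hExpInt m) (hExpInt (-m))]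
          exact integral_add ((hExpInt r).add (hExpInt (-r))) ((hExpInt m).add (hExpInt (-m)))
        rw [integral_const_mul, e1, hsp]
        have h1 := hle r hre
        have h2 := hle (-r) (by simpa using hre)
        have h3 := hle m him
        have h4 := hle (-m) (by simpa using him)
        calc _ ≤ B * s ^ p * (Real.exp (1/2) + Real.exp (1/2) +
              (Real.exp (1/2) + Real.exp (1/2))) := by gcongr
          _ = _ := by ring

/-- The point with real coordinates, as an element of the torus, where the coordinates in `S`
are multiplied by `t`. -/
noncomputable def shiftT (n : ℕ) (S : Finset (Fin n)) (u : Fin n → ℝ) (t : ℝ) :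
    Fin n → AddCircle (1 : ℝ) :=
  fun j => (((if j ∈ S then t else 1) * u j : ℝ) : AddCircle (1 : ℝ))

lemma torusChar_add (n : ℕ) (g : Fin n → ℤ) (x y : Fin n → AddCircle (1 : ℝ)) :
    torusChar n g (x + y) = torusChar n g x * torusChar n g y := by
  simp only [torusChar, ← Finset.prod_mul_distrib, Pi.add_apply, smul_add,
    AddCircle.toCircle_add, Circle.coe_mul]

lemma toCircle_zsmul_coe (m : ℤ) (s : ℝ) :
    (AddCircle.toCircle (m • (s : AddCircle (1 : ℝ))) : ℂ) =
      Complex.exp ((2 * Real.pi * Complex.I * m) * s) := by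
  rw [AddCircle.toCircle_zsmul, AddCircle.toCircle_apply_mk, Circle.coe_zpow, Circle.coe_exp,
    ← Complex.exp_int_mul]
  congr 1
  push_cast
  ring

lemma continuous_torusChar (n : ℕ) (g : Fin n → ℤ) : Continuous (torusChar n g) := by
  unfold torusChar
  refine continuous_finsetProd _ fun j _ => ?_
  exact continuous_subtype_val.comp (AddCircle.continuous_toCircle.comp (by fun_prop))

lemma continuous_shiftT (n : ℕ) (S : Finset (Fin n)) :
    Continuous (fun q : (Fin n → ℝ) × ℝ => shiftT n S q.1 q.2) := by
  unfold shiftT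
  refine continuous_pi fun j => ?_
  by_cases h : j ∈ S
  · simp only [h, if_true]; fun_prop
  · simp only [h, if_false]; fun_prop

lemma continuous_derivF (n : ℕ) (c : (Fin n → ℤ) →₀ ℂ) (j : Fin n) :
    Continuous (derivF n c j) := by
  unfold derivF
  exact continuous_finsetSum _ fun g _ => continuous_const.mul (continuous_torusChar n g)

lemma continuous_trigPoly (n : ℕ) (c : (Fin n → ℤ) →₀ ℂ) : Continuous (trigPoly n c) := by
  unfold trigPoly
  exact continuous_finsetSum _ fun g _ => continuous_const.mul (continuous_torusChar n g)

lemma torusChar_shift (n : ℕ) (g : Fin n → ℤ) (S : Finset (Fin n)) (u : Fin n → ℝ) (t : ℝ) :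
    torusChar n g (shiftT n S u t) =
      ∏ j, Complex.exp ((2 * Real.pi * Complex.I * g j) * ((if j ∈ S then t else 1) * u j)) := by
  unfold torusChar shiftT
  refine Finset.prod_congr rfl fun j _ => ?_
  rw [toCircle_zsmul_coe]
  push_cast
  split_ifs <;> simp

lemma box_char (m : ℤ) : ∫ u : ℝ, Complex.exp ((2 * Real.pi * Complex.I * m) * u) ∂boxM =
    if m = 0 then 1 else 0 := by
  split_ifs with h
  · simp [h]
  · have hm : (2 * Real.pi * Complex.I * m : ℂ) ≠ 0 := by
      have : (m : ℂ) ≠ 0 := by exact_mod_cast h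
      have := Complex.two_pi_I_ne_zero
      positivity
    rw [boxM, ← intervalIntegral.integral_of_le (by norm_num), integral_exp_mul_complex hm]
    have : Complex.exp ((2 * Real.pi * Complex.I * m) * ((1/2 : ℝ) : ℂ)) =
        Complex.exp ((2 * Real.pi * Complex.I * m) * ((-1/2 : ℝ) : ℂ)) := by
      rw [Complex.exp_eq_exp_iff_exists_int]
      refine ⟨m, ?_⟩
      push_cast
      ring
    rw [this, sub_self, zero_div]

lemma box_exp_integrable (z : ℂ) : Integrable (fun u : ℝ => Complex.exp (z * u)) boxM := by
  have : Continuous (fun u : ℝ => Complex.exp (z * u)) := by fun_prop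
  rw [boxM]
  exact (this.integrableOn_Icc (a := -1/2) (b := 1/2)).mono_set Set.Ioc_subset_Icc_self

lemma char_int (n : ℕ) (g : Fin n → ℤ) (S : Finset (Fin n)) :
    Integrable (fun u => torusChar n g (shiftT n S u 0)) (Measure.pi fun _ => boxM) ∧
    ∫ u : Fin n → ℝ, torusChar n g (shiftT n S u 0) ∂(Measure.pi fun _ => boxM) =
      if (∀ j ∉ S, g j = 0) then 1 else 0 := by
  have h : (fun u => torusChar n g (shiftT n S u 0)) = fun u => ∏ j,
      (fun x : ℝ => Complex.exp
        ((2 * Real.pi * Complex.I * ((if j ∈ S then 0 else g j : ℤ) : ℂ)) * x)) (u j) := by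
    funext u
    rw [torusChar_shift]
    refine Finset.prod_congr rfl fun j _ => ?_
    split_ifs <;> simp
  rw [h]
  refine ⟨Integrable.fintype_prod (fun i => box_exp_integrable _), ?_⟩
  rw [integral_fintype_prod_eq_prod (𝕜 := ℂ) (fun j (x : ℝ) => Complex.exp
        ((2 * Real.pi * Complex.I * ((if j ∈ S then 0 else g j : ℤ) : ℂ)) * x))]
  simp_rw [box_char]
  rw [Finset.prod_ite_zero]
  congr 1
  · simp
  · simp

lemma trig_int (n : ℕ) (c : (Fin n → ℤ) →₀ ℂ) (S : Finset (Fin n))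
    (x : Fin n → AddCircle (1 : ℝ)) :
    Integrable (fun u => trigPoly n c (x + shiftT n S u 0)) (Measure.pi fun _ => boxM) ∧
    ∫ u : Fin n → ℝ, trigPoly n c (x + shiftT n S u 0) ∂(Measure.pi fun _ => boxM) =
      truncF n c S x := by
  unfold trigPoly truncF
  simp_rw [torusChar_add]
  have h : ∀ g, Integrable (fun u => c g * (torusChar n g x * torusChar n g (shiftT n S u 0)))
      (Measure.pi fun _ => boxM) := fun g => ((char_int n g S).1.const_mul _).const_mul _
  refine ⟨integrable_finsetSum _ fun g _ => h g, ?_⟩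
  rw [integral_finsetSum _ fun g _ => h g, Finset.sum_filter]
  refine Finset.sum_congr rfl fun g _ => ?_
  rw [integral_const_mul, integral_const_mul, (char_int n g S).2]
  split_ifs <;> simp

lemma truncF_empty (n : ℕ) (c : (Fin n → ℤ) →₀ ℂ) (hc : c 0 = 0)
    (x : Fin n → AddCircle (1 : ℝ)) : truncF n c ∅ x = 0 := by
  unfold truncF
  refine Finset.sum_eq_zero fun g hg => ?_
  simp only [Finset.mem_filter, Finset.notMem_empty, not_false_eq_true, forall_const] at hg
  have : g = 0 := funext hg.2
  rw [this, hc, zero_mul]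

lemma shiftT_one (n : ℕ) (S : Finset (Fin n)) (u : Fin n → ℝ) :
    shiftT n S u 1 = shiftT n ∅ u 0 := by
  unfold shiftT; simp

lemma trig_deriv (n : ℕ) (c : (Fin n → ℤ) →₀ ℂ) (S : Finset (Fin n))
    (x : Fin n → AddCircle (1 : ℝ)) (u : Fin n → ℝ) (t : ℝ) :
    HasDerivAt (fun t : ℝ => trigPoly n c (x + shiftT n S u t))
      (∑ j, (u j : ℂ) * (if j ∈ S then derivF n c j (x + shiftT n S u t) else 0)) t := by
  have h1 : ∀ g : Fin n → ℤ, HasDerivAt (fun t : ℝ => torusChar n g (shiftT n S u t))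
      ((∑ j, if j ∈ S then (2 * Real.pi * Complex.I * g j) * u j else 0) *
        torusChar n g (shiftT n S u t)) t := by
    intro g
    have h2 : ∀ t : ℝ, torusChar n g (shiftT n S u t) = Complex.exp
        (∑ j, (2 * Real.pi * Complex.I * g j) * ((if j ∈ S then (t:ℂ) else 1) * u j)) := by
      intro t
      rw [torusChar_shift, Complex.exp_sum]
      refine Finset.prod_congr rfl fun j _ => ?_
      split_ifs <;> simp
    simp_rw [h2]
    rw [mul_comm (∑ j, if j ∈ S then (2 * Real.pi * Complex.I * g j) * u j else (0 : ℂ))]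
    refine HasDerivAt.cexp (HasDerivAt.fun_sum fun j _ => ?_)
    have hid : HasDerivAt (fun t : ℝ => (t : ℂ)) 1 t := Complex.ofRealCLM.hasDerivAt
    split_ifs
    · have := (hid.mul_const (u j : ℂ)).const_mul (2 * Real.pi * Complex.I * g j)
      simpa using this
    · exact hasDerivAt_const _ _
  have h3 : ∑ j, (u j : ℂ) * (if j ∈ S then derivF n c j (x + shiftT n S u t) else 0) =
      ∑ g ∈ c.support, c g * (torusChar n g x *
        ((∑ j, if j ∈ S then (2 * Real.pi * Complex.I * g j) * u j else 0) *
        torusChar n g (shiftT n S u t))) := by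
    unfold derivF
    simp_rw [torusChar_add]
    simp_rw [Finset.sum_mul, Finset.mul_sum]
    rw [Finset.sum_comm]
    refine Finset.sum_congr rfl fun j _ => ?_
    split_ifs
    · rw [Finset.mul_sum]
      refine Finset.sum_congr rfl fun g _ => by ring
    · simp
  rw [h3]
  unfold trigPoly
  simp_rw [torusChar_add]
  exact HasDerivAt.fun_sum fun g _ => ((h1 g).const_mul _).const_mul _

lemma poinc (p : ℝ) (hp : 2 ≤ p) (n : ℕ) (c : (Fin n → ℤ) →₀ ℂ) (hc : c 0 = 0)
    (S : Finset (Fin n)) :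
    ∫⁻ x, ‖truncF n c S x‖ₑ ^ p ≤ ∫⁻ x, ∫⁻ u : Fin n → ℝ,
      ‖∑ j, (u j : ℂ) * (if j ∈ S then derivF n c j x else 0)‖ₑ ^ p
        ∂(Measure.pi fun _ => boxM) := by
  set ν : Measure ℝ := volume.restrict (Set.Ioc 0 1) with hν
  have : IsProbabilityMeasure ν := by
    constructor
    rw [hν, Measure.restrict_apply_univ, Real.volume_Ioc]
    norm_num
  set μ : Measure (Fin n → ℝ) := Measure.pi fun _ => boxM with hμ
  set D : (Fin n → AddCircle (1 : ℝ)) → (Fin n → ℝ) → ℂ := fun x u =>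
    ∑ j, (u j : ℂ) * (if j ∈ S then derivF n c j x else 0) with hD
  have hDc : Continuous (fun q : (Fin n → AddCircle (1 : ℝ)) × (Fin n → ℝ) => D q.1 q.2) := by
    rw [hD]
    refine continuous_finsetSum _ fun j _ => ?_
    have := continuous_derivF n c j
    split_ifs <;> fun_prop
  have hsc := continuous_shiftT n S
  -- G x q is the derivative along the path
  have hGc : Continuous (fun r : (Fin n → AddCircle (1 : ℝ)) × ((Fin n → ℝ) × ℝ) =>
      D (r.1 + shiftT n S r.2.1 r.2.2) r.2.1) := by
    have h1 : Continuous (fun r : (Fin n → AddCircle (1 : ℝ)) × ((Fin n → ℝ) × ℝ) =>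
      (r.1 + shiftT n S r.2.1 r.2.2, r.2.1)) :=
      (continuous_fst.add (hsc.comp continuous_snd)).prodMk (continuous_fst.comp continuous_snd)
    exact hDc.comp h1
  have hbound : ∀ x, ‖truncF n c S x‖ₑ ≤
      ∫⁻ q : (Fin n → ℝ) × ℝ, ‖D (x + shiftT n S q.1 q.2) q.1‖ₑ ∂(μ.prod ν) := by
    intro x
    have hGx : Continuous (fun q : (Fin n → ℝ) × ℝ => D (x + shiftT n S q.1 q.2) q.1) :=
      hGc.comp (Continuous.prodMk_right x)
    have e1 : truncF n c S x = ∫ u, (trigPoly n c (x + shiftT n S u 0) -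
        trigPoly n c (x + shiftT n S u 1)) ∂μ := by
      simp_rw [shiftT_one]
      rw [integral_sub (trig_int n c S x).1 (trig_int n c ∅ x).1, (trig_int n c S x).2,
        (trig_int n c ∅ x).2, truncF_empty n c hc, sub_zero]
    rw [e1]
    refine (enorm_integral_le_lintegral_enorm _).trans ?_
    rw [lintegral_prod _ hGx.enorm.measurable.aemeasurable]
    refine lintegral_mono fun u => ?_
    have hGu : Continuous (fun t : ℝ => D (x + shiftT n S u t) u) :=
      hGx.comp (Continuous.prodMk_right u)
    have e2 := intervalIntegral.integral_eq_sub_of_hasDerivAt (a := 0) (b := 1)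
      (fun t _ => trig_deriv n c S x u t) (hGu.intervalIntegrable _ _)
    rw [← neg_sub, ← e2, enorm_neg, intervalIntegral.integral_of_le zero_le_one]
    exact enorm_integral_le_lintegral_enorm _
  calc ∫⁻ x, ‖truncF n c S x‖ₑ ^ p
      ≤ ∫⁻ x, ∫⁻ q : (Fin n → ℝ) × ℝ, ‖D (x + shiftT n S q.1 q.2) q.1‖ₑ ^ p ∂(μ.prod ν) := by
        refine lintegral_mono fun x => ?_
        refine (ENNReal.rpow_le_rpow (hbound x) (by linarith)).trans ?_
        refine lintegral_rpow_jensen _ _ ?_ p (by linarith)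
        exact (hGc.comp (Continuous.prodMk_right x)).enorm.measurable.aemeasurable
    _ = ∫⁻ q : (Fin n → ℝ) × ℝ, ∫⁻ x, ‖D (x + shiftT n S q.1 q.2) q.1‖ₑ ^ p
          ∂(volume : Measure (Fin n → AddCircle (1 : ℝ))) ∂(μ.prod ν) := by
        refine lintegral_lintegral_swap ?_
        exact (hGc.enorm.measurable.pow_const p).aemeasurable
    _ = ∫⁻ q : (Fin n → ℝ) × ℝ, ∫⁻ x, ‖D x q.1‖ₑ ^ p ∂volume ∂(μ.prod ν) := by
        refine lintegral_congr fun q => ?_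
        exact lintegral_add_right_eq_self (fun x => ‖D x q.1‖ₑ ^ p) _
    _ = ∫⁻ u, ∫⁻ x, ‖D x u‖ₑ ^ p ∂volume ∂μ := by
        have hm : Measurable (fun q : (Fin n → ℝ) × (Fin n → AddCircle (1 : ℝ)) =>
            ‖D q.2 q.1‖ₑ ^ p) :=
          (hDc.comp continuous_swap).enorm.measurable.pow_const p
        have hm2 : Measurable (fun u => ∫⁻ x, ‖D x u‖ₑ ^ p) := hm.lintegral_prod_right'
        have hm3 : Measurable (fun q : (Fin n → ℝ) × ℝ => ∫⁻ x, ‖D x q.1‖ₑ ^ p) :=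
          hm2.comp measurable_fst
        rw [lintegral_prod _ hm3.aemeasurable]
        simp
    _ = _ := by
        refine lintegral_lintegral_swap ?_
        exact ((hDc.comp continuous_swap).enorm.measurable.pow_const p).aemeasurable

lemma gradSign_eq (n : ℕ) (c : (Fin n → ℤ) →₀ ℂ) (ε : Fin n → Bool)
    (x : Fin n → AddCircle (1 : ℝ)) :
    gradSignF n c ε x = ∑ j, (if ε j then (1 : ℂ) else -1) * derivF n c j x := by
  unfold gradSignF derivF
  simp_rw [Finset.mul_sum, Finset.sum_mul]
  rw [Finset.sum_comm]
  refine Finset.sum_congr rfl fun j _ => Finset.sum_congr rfl fun g _ => by ring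

lemma pointwise_real (p : ℝ) (hp : 2 ≤ p) : ∃ C : ℝ, 0 ≤ C ∧ ∀ (n k : ℕ), 0 < n →
    ∀ a : Fin n → ℂ,
    ∑ S ∈ (Finset.univ : Finset (Fin n)).powersetCard k, (∑ j ∈ S, ‖a j‖ ^ 2) ^ (p / 2) ≤
      C * ((n.choose k : ℝ) * (((k : ℝ) / n) * ∑ j, ‖a j‖ ^ p +
        ((k : ℝ) / n) ^ (p / 2) * ((1 / 2 ^ n) * ∑ ε : Fin n → Bool,
          ‖∑ j, (if ε j then (1:ℂ) else -1) * a j‖ ^ p))) := by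
  set q := p / 2 with hq
  have hq1 : 1 ≤ q := by rw [hq]; linarith
  have hpq : p = 2 * q := by rw [hq]; ring
  set C1 : ℝ := 2 * 2 ^ (q - 1) with hC1
  set C2 : ℝ := 2 * (2 * 2 ^ (q - 1)) ^ q with hC2
  have hC1' : 0 ≤ C1 := by positivity
  have hC2' : 0 ≤ C2 := by positivity
  refine ⟨C1 + C2, by positivity, fun n k hn a => ?_⟩
  have : Nonempty (Fin n) := ⟨⟨0, hn⟩⟩
  have h1 := samp2 k (fun j => ‖a j‖ ^ 2) (fun _ => by positivity) q hq1
  rw [Fintype.card_fin] at h1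
  refine h1.trans ?_
  have h2 := sign_lower n a q hq1
  rw [← hpq] at h2
  have h3 : ∀ j, (‖a j‖ ^ 2) ^ q = ‖a j‖ ^ p := by
    intro j
    rw [hpq, Real.rpow_mul (norm_nonneg _), Real.rpow_two]
  simp_rw [h3]
  have hs : 0 ≤ ∑ j, ‖a j‖ ^ 2 := Finset.sum_nonneg fun _ _ => by positivity
  rw [Real.mul_rpow (by positivity) hs]
  set U := (k : ℝ) / n * ∑ j, ‖a j‖ ^ p with hU
  set W := (1 / 2 ^ n) * ∑ ε : Fin n → Bool,
          ‖∑ j, (if ε j then (1:ℂ) else -1) * a j‖ ^ p with hW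
  set κ := ((k : ℝ) / n) ^ q with hκ
  have hκ0 : 0 ≤ κ := by positivity
  have hU0 : 0 ≤ U := mul_nonneg (by positivity) (Finset.sum_nonneg fun _ _ => by positivity)
  have hW0 : 0 ≤ W := mul_nonneg (by positivity) (Finset.sum_nonneg fun _ _ => by positivity)
  have h4 : κ * (∑ j, ‖a j‖ ^ 2) ^ q ≤ κ * W := by gcongr
  have h5 : C1 * U + C2 * (κ * (∑ j, ‖a j‖ ^ 2) ^ q) ≤ (C1 + C2) * (U + κ * W) := by
    have : 0 ≤ κ * W := by positivity
    nlinarith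
  calc _ ≤ (n.choose k : ℝ) * ((C1 + C2) * (U + κ * W)) := by gcongr
    _ = _ := by ring

lemma eLpNorm_pow {α : Type*} [MeasurableSpace α] (μ : Measure α) (f : α → ℂ) (p : ℝ)
    (hp : 2 ≤ p) : (eLpNorm f (ENNReal.ofReal p) μ) ^ p = ∫⁻ x, ‖f x‖ₑ ^ p ∂μ := by
  rw [eLpNorm_eq_lintegral_rpow_enorm_toReal (by simp; linarith) ENNReal.ofReal_ne_top,
    ENNReal.toReal_ofReal (by linarith), ← ENNReal.rpow_mul, one_div_mul_cancel (by linarith),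
    ENNReal.rpow_one]

lemma main_aux (p : ℝ) (hp : 2 ≤ p) :
    ∃ C : ℝ≥0∞, C ≠ ⊤ ∧ ∀ (n k : ℕ), k ≤ n → 0 < n →
      ∀ c : (Fin n → ℤ) →₀ ℂ, c 0 = 0 →
      (1 / (n.choose k : ℝ≥0∞)) *
          ∑ S ∈ Finset.univ.powersetCard k,
            (eLpNorm (truncF n c S) (ENNReal.ofReal p) volume) ^ p
        ≤ C * (((k : ℝ≥0∞) / n) *
              ∑ j : Fin n, (eLpNorm (derivF n c j) (ENNReal.ofReal p) volume) ^ p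
            + ((k : ℝ≥0∞) / n) ^ (p / 2) * ((1 / 2 ^ n : ℝ≥0∞) *
              ∑ ε : Fin n → Bool,
                (eLpNorm (gradSignF n c ε) (ENNReal.ofReal p) volume) ^ p)) := by
  obtain ⟨K, hK0, hK⟩ := khin p hp
  obtain ⟨C, hC0, hC⟩ := pointwise_real p hp
  refine ⟨ENNReal.ofReal (K * C), ENNReal.ofReal_ne_top, fun n k hkn hn c hc => ?_⟩
  have hN : 0 < n.choose k := Nat.choose_pos hkn
  simp_rw [eLpNorm_pow _ _ p hp]
  have hdm : ∀ j, Measurable (derivF n c j) := fun j => (continuous_derivF n c j).measurable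
  have hgm : ∀ ε, Measurable (gradSignF n c ε) := fun ε => by
    have : gradSignF n c ε = fun x => ∑ j, (if ε j then (1 : ℂ) else -1) * derivF n c j x :=
      funext fun x => gradSign_eq n c ε x
    rw [this]
    fun_prop
  have hkn' : ((k : ℝ≥0∞) / n) = ENNReal.ofReal ((k : ℝ) / n) := by
    rw [ENNReal.ofReal_div_of_pos (by exact_mod_cast hn)]
    simp
  have h2n : (1 / 2 ^ n : ℝ≥0∞) = ENNReal.ofReal (1 / 2 ^ n) := by
    rw [ENNReal.ofReal_div_of_pos (by positivity), ENNReal.ofReal_pow (by norm_num)]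
    simp
  have hen : ∀ z : ℂ, ‖z‖ₑ ^ p = ENNReal.ofReal (‖z‖ ^ p) := by
    intro z
    rw [← ofReal_norm, ENNReal.ofReal_rpow_of_nonneg (norm_nonneg _) (by linarith)]
  -- step 1
  have h1 : ∀ S : Finset (Fin n), ∫⁻ x, ‖truncF n c S x‖ₑ ^ p ≤
      ∫⁻ x, ENNReal.ofReal (K * (∑ j ∈ S, ‖derivF n c j x‖ ^ 2) ^ (p / 2)) := by
    intro S
    refine (poinc p hp n c hc S).trans (lintegral_mono fun x => ?_)
    refine (hK n fun j => if j ∈ S then derivF n c j x else 0).trans (le_of_eq ?_)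
    congr 3
    rw [← Finset.sum_subset (Finset.subset_univ S)]
    · exact Finset.sum_congr rfl fun j hj => by rw [if_pos hj]
    · intro j _ hj
      simp [hj]
  have h2 : ∑ S ∈ Finset.univ.powersetCard k, ∫⁻ x, ‖truncF n c S x‖ₑ ^ p ≤
      ∫⁻ x, (n.choose k : ℝ≥0∞) * (ENNReal.ofReal (K * C) * (((k : ℝ≥0∞) / n) *
        ∑ j, ‖derivF n c j x‖ₑ ^ p + ((k : ℝ≥0∞) / n) ^ (p / 2) * ((1 / 2 ^ n : ℝ≥0∞) *
          ∑ ε : Fin n → Bool, ‖gradSignF n c ε x‖ₑ ^ p))) := by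
    refine (Finset.sum_le_sum fun S _ => h1 S).trans ?_
    rw [← lintegral_finsetSum]
    · refine lintegral_mono fun x => ?_
      simp only
      rw [← ENNReal.ofReal_sum_of_nonneg (fun S _ => by positivity)]
      have e1 := hC n k hn (fun j => derivF n c j x)
      simp_rw [← gradSign_eq] at e1
      simp_rw [hen, hkn', h2n]
      rw [← Finset.mul_sum, ← ENNReal.ofReal_sum_of_nonneg (fun _ _ => by positivity),
        ← ENNReal.ofReal_sum_of_nonneg (fun _ _ => by positivity),
        ENNReal.ofReal_rpow_of_nonneg (by positivity) (by linarith),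
        ← ENNReal.ofReal_mul (by positivity), ← ENNReal.ofReal_mul (by positivity),
        ← ENNReal.ofReal_mul (by positivity), ← ENNReal.ofReal_add (by positivity) (by positivity),
        ← ENNReal.ofReal_mul (by positivity), ← ENNReal.ofReal_natCast,
        ← ENNReal.ofReal_mul (by positivity)]
      refine ENNReal.ofReal_le_ofReal ?_
      refine (mul_le_mul_of_nonneg_left e1 hK0).trans (le_of_eq ?_)
      ring
    · intro S _
      fun_prop
  refine (mul_le_mul_right h2 (1 / (n.choose k : ℝ≥0∞))).trans (le_of_eq ?_)
  rw [lintegral_const_mul _ (by fun_prop), lintegral_const_mul _ (by fun_prop),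
        lintegral_add_left (by fun_prop), lintegral_const_mul _ (by fun_prop),
        lintegral_const_mul _ (by fun_prop), lintegral_const_mul _ (by fun_prop),
        lintegral_finsetSum _ (by fun_prop), lintegral_finsetSum _ (by fun_prop),
        ← mul_assoc, ENNReal.div_mul_cancel (by exact_mod_cast hN.ne') (by finiteness), one_mul]

/-- for p ≥ 2 and mean-zero f ∈ L_p(𝕋ⁿ),
(1/C(n,k)) ∑_{|S|=k} ‖f_S‖_p^p ≲_p (k/n) ∑_j ‖∂_{e_j} f‖_p^p + (k/n)^{p/2} ‖∇f‖_p^p,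
where ‖∇f‖_p^p = E_ε ‖∑_j ε_j ∂_{e_j} f‖_p^p. -/
theorem poincare_rosenthal_truncations (p : ℝ) (hp : 2 ≤ p) :
    ∃ C : ℝ≥0∞, C ≠ ⊤ ∧ ∀ (n k : ℕ), k ≤ n →
      ∀ c : (Fin n → ℤ) →₀ ℂ, c 0 = 0 →
      (1 / (n.choose k : ℝ≥0∞)) *
          ∑ S ∈ Finset.univ.powersetCard k,
            (eLpNorm (truncF n c S) (ENNReal.ofReal p) volume) ^ p
        ≤ C * (((k : ℝ≥0∞) / n) *
              ∑ j : Fin n, (eLpNorm (derivF n c j) (ENNReal.ofReal p) volume) ^ p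
            + ((k : ℝ≥0∞) / n) ^ (p / 2) * ((1 / 2 ^ n : ℝ≥0∞) *
              ∑ ε : Fin n → Bool,
                (eLpNorm (gradSignF n c ε) (ENNReal.ofReal p) volume) ^ p)) := by
  obtain ⟨C, hC, h⟩ := main_aux p hp
  refine ⟨C, hC, fun n k hkn c hc => ?_⟩
  rcases Nat.eq_zero_or_pos n with hn | hn
  · subst hn
    have : k = 0 := by omega
    subst this
    have h0 : truncF 0 c ∅ = 0 := funext fun x => truncF_empty 0 c hc x
    have hp0 : 0 < p := by linarith
    simp [h0, hp0]
  · exact h n k hkn hn c hc
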